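/- Let T = (Q, Σ, δ) be an S-automaton. The automaton semigroup S(T) is infinite if and only if there is an ω-word ξ ∈ Σ^ω with infinite orbit Q*∘ξ = {𝐪∘ξ ∣ 𝐪 ∈ Q*, 𝐪∘ defined on ξ}. -/

import Mathlib

/- Common framework for automaton semigroups acting on finite and infinite words.

An S-automaton over states `Q` and alphabet `A` is given by a partial deterministic
transition function `δ : Q → A → Option (A × Q)` (with `δ q a = some (b, p)` encoding
the transition `q –a/b→ p`). -/

namespace AutOrbit

variable {Q A : Type*}

/-- The partial action `q∘` of a single state on a finite word. -/
def stateAct (δ : Q → A → Option (A × Q)) : Q → List A → Option (List A)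
  | _, [] => some []
  | q, a :: u => (δ q a).bind fun bp => (stateAct δ bp.2 u).map fun v => bp.1 :: v

/-- The partial action `𝐪∘` of a state sequence `𝐪 = q_n … q_1` (written left-to-right,
head of the list is `q_n`; the rightmost state `q_1` is applied first). -/
def seqAct (δ : Q → A → Option (A × Q)) (l : List Q) (u : List A) : Option (List A) :=
  l.foldr (fun q acc => acc.bind (stateAct δ q)) (some u)

/-- The length-`n` prefix of an ω-word. -/
def pre (ξ : ℕ → A) (n : ℕ) : List A := List.ofFn fun i : Fin n => ξ i

/-- The `L`-orbit `L∘u` of a finite word `u`. -/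
def orbit (δ : Q → A → Option (A × Q)) (L : Set (List Q)) (u : List A) : Set (List A) :=
  {v | ∃ l ∈ L, seqAct δ l u = some v}

/-- The `L`-orbit `L∘ξ` of an ω-word `ξ`: all ω-words `η` such that some `𝐪 ∈ L` is
defined on `ξ` with `𝐪∘ξ = η` (i.e. `𝐪∘` maps every prefix of `ξ` to the
corresponding prefix of `η`). -/
def omegaOrbit (δ : Q → A → Option (A × Q)) (L : Set (List Q)) (ξ : ℕ → A) :
    Set (ℕ → A) :=
  {η | ∃ l ∈ L, ∀ n, seqAct δ l (pre ξ n) = some (pre η n)}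

/-- The set of partial maps `L∘ = {𝐪∘ ∣ 𝐪 ∈ L}`. -/
def mapsOf (δ : Q → A → Option (A × Q)) (L : Set (List Q)) :
    Set (List A → Option (List A)) :=
  {f | ∃ l ∈ L, f = seqAct δ l}

/-- `L ⊆ F*` is suffix-closed over `F`: every `𝐪 ∈ L` factorizes into factors from `F`
such that every suffix (as a word over the alphabet `F`) of the factorization is
again in `L`. -/
def SuffixClosedOver (F L : Set (List Q)) : Prop :=
  ∀ l ∈ L, ∃ fs : List (List Q),
    (∀ f ∈ fs, f ∈ F) ∧ fs.flatten = l ∧ ∀ i, (fs.drop i).flatten ∈ L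

/-- `L` is finitely suffix-closed: suffix-closed over some finite nonempty `F ⊆ Q*`. -/
def FinitelySuffixClosed (L : Set (List Q)) : Prop :=
  ∃ F : Set (List Q), F.Finite ∧ F.Nonempty ∧ SuffixClosedOver F L

/-- `u` has infinite potential w.r.t. `δ` and `L`: the orbit sizes `|L∘ux|` are unbounded. -/
def InfinitePotential (δ : Q → A → Option (A × Q)) (L : Set (List Q)) (u : List A) : Prop :=
  ∀ C : ℕ, ∃ x : List A, C < (orbit δ L (u ++ x)).ncard

/-- The `i`-th power `𝐪^i` of a state sequence. -/
def listPow (l : List Q) (i : ℕ) : List Q := (List.replicate i l).flatten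

/-- `𝐪∘` has torsion: two distinct positive powers induce the same partial map. -/
def HasTorsion (δ : Q → A → Option (A × Q)) (l : List Q) : Prop :=
  ∃ i j : ℕ, 1 ≤ i ∧ 1 ≤ j ∧ i ≠ j ∧ seqAct δ (listPow l i) = seqAct δ (listPow l j)

/-- The automaton is complete: `δ` is total. -/
def Complete (δ : Q → A → Option (A × Q)) : Prop := ∀ q a, (δ q a).isSome

/-- The automaton is invertible: for every state, the letter-to-output-letter map is a
bijection of the alphabet (each output letter is produced by exactly one input letter). -/
def Invertible (δ : Q → A → Option (A × Q)) : Prop :=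
  ∀ q b, ∃! a, ∃ p, δ q a = some (b, p)

/-- A G-automaton: a complete invertible S-automaton. -/
def GAutomaton (δ : Q → A → Option (A × Q)) : Prop := Complete δ ∧ Invertible δ

/-- Reversibility: for every input letter `a` and target state `p` there is at most one
transition `q –a/b→ p`. -/
def Reversible (δ : Q → A → Option (A × Q)) : Prop :=
  ∀ a p q₁ b₁ q₂ b₂, δ q₁ a = some (b₁, p) → δ q₂ a = some (b₂, p) → q₁ = q₂

/-- Reversibility of the inverse automaton: for every output letter `b` and target
state `p` there is at most one transition `q –a/b→ p`. -/
def InvReversible (δ : Q → A → Option (A × Q)) : Prop :=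
  ∀ b p q₁ a₁ q₂ a₂, δ q₁ a₁ = some (b, p) → δ q₂ a₂ = some (b, p) → q₁ = q₂ ∧ a₁ = a₂

/-- Bi-reversibility: the automaton and its inverse automaton are both reversible. -/
def BiReversible (δ : Q → A → Option (A × Q)) : Prop := Reversible δ ∧ InvReversible δ

/-- The dual automaton `∂T`: states are letters, letters are states; it has a transition
`a –q/p→ b` for every transition `q –a/b→ p` of `T`. -/
def dual (δ : Q → A → Option (A × Q)) : A → Q → Option (Q × A) :=
  fun a q => (δ q a).map fun bp => (bp.2, bp.1)

/-- Adjacency of states in the underlying undirected graph of the automaton. -/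
def Adj (δ : Q → A → Option (A × Q)) (q p : Q) : Prop :=
  (∃ a b, δ q a = some (b, p)) ∨ (∃ a b, δ p a = some (b, q))

/-- `P` is (the state set of) a connected component of the automaton. -/
def IsComponent (δ : Q → A → Option (A × Q)) (P : Set Q) : Prop :=
  ∃ q, P = {p | Relation.ReflTransGen (Adj δ) q p}

/-- The sub-automaton induced on `P` (with all transitions among states of `P`)
is reversible. -/
def SubReversible (δ : Q → A → Option (A × Q)) (P : Set Q) : Prop :=
  ∀ a : A, ∀ p ∈ P, ∀ q₁ b₁ q₂ b₂, q₁ ∈ P → q₂ ∈ P →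
    δ q₁ a = some (b₁, p) → δ q₂ a = some (b₂, p) → q₁ = q₂

/-- The inverse of the sub-automaton induced on `P` is reversible. -/
def SubInvReversible (δ : Q → A → Option (A × Q)) (P : Set Q) : Prop :=
  ∀ b : A, ∀ p ∈ P, ∀ q₁ a₁ q₂ a₂, q₁ ∈ P → q₂ ∈ P →
    δ q₁ a₁ = some (b, p) → δ q₂ a₂ = some (b, p) → q₁ = q₂ ∧ a₁ = a₂

/-- The sub-automaton induced on `P` is bi-reversible. -/
def SubBiReversible (δ : Q → A → Option (A × Q)) (P : Set Q) : Prop :=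
  SubReversible δ P ∧ SubInvReversible δ P

/-- For a complete automaton, the (total) action of a state on a finite word. -/
noncomputable def totAct (δ : Q → A → Option (A × Q)) (q : Q) (u : List A) : List A :=
  (stateAct δ q u).getD u

/-- The action of a state of the automaton (`Sum.inl`) or of its inverse automaton
(`Sum.inr`): for a G-automaton, `totAct δ q` is a bijection of `Σ*` and the inverse
state `q̄` acts as its inverse bijection. -/
noncomputable def gAct (δ : Q → A → Option (A × Q)) : Q ⊕ Q → List A → List A
  | Sum.inl q => totAct δ q
  | Sum.inr q => Function.invFun (totAct δ q)

/-- Action of a sequence over `Q ⊔ Q̄` (rightmost entry applied first). -/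
noncomputable def gSeqAct (δ : Q → A → Option (A × Q)) (l : List (Q ⊕ Q)) (u : List A) :
    List A :=
  l.foldr (fun s v => gAct δ s v) u

/-- The automaton group `G(T) = {𝐪∘ ∣ 𝐪 ∈ (Q ⊔ Q̄)⁺}` as a set of maps on `Σ*`. -/
def autGroup (δ : Q → A → Option (A × Q)) : Set (List A → List A) :=
  {f | ∃ l : List (Q ⊕ Q), l ≠ [] ∧ f = gSeqAct δ l}

/-- The ultimately periodic ω-word `u (a v)^ω`. -/
def ultPer (u : List A) (a : A) (v : List A) (n : ℕ) : A :=
  if h : n < u.length then u.get ⟨n, h⟩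
  else (a :: v).get ⟨(n - u.length) % (a :: v).length, Nat.mod_lt _ (by simp)⟩

/-- Run of a single state on a word, returning the output word and the final state. -/
def runState (δ : Q → A → Option (A × Q)) : Q → List A → Option (List A × Q)
  | q, [] => some ([], q)
  | q, a :: u => (δ q a).bind fun bp =>
      (runState δ bp.2 u).map fun vr => (bp.1 :: vr.1, vr.2)

/-- Run of a state sequence `𝐪` on a word `u`, returning the output word `𝐪∘u` and the
residual state sequence `𝐪·u` (the dual action). -/
def runSeq (δ : Q → A → Option (A × Q)) : List Q → List A → Option (List A × List Q)
  | [], u => some (u, [])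
  | q :: l, u => (runSeq δ l u).bind fun vr =>
      (runState δ q vr.1).map fun wp => (wp.1, wp.2 :: vr.2)

/-- Nodes of the `L`-orbital transducer over `F` of `u`: words reached from `u` along a
path of `F`-labeled edges whose reverse label (a word over `F`) lies in `L`. -/
def transNodes (δ : Q → A → Option (A × Q)) (F L : Set (List Q)) (u : List A) :
    Set (List A) :=
  {v | ∃ fs : List (List Q), (∀ f ∈ fs, f ∈ F) ∧ fs.flatten ∈ L ∧
        ∃ r, runSeq δ fs.flatten u = some (v, r)}

/-- Edges of the `L`-orbital transducer over `F` of `u`: an edge `v –𝐩/𝐨→ w` with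
`𝐩 ∈ F`, input label `𝐩`, output label `𝐨 = 𝐩·v`, lying on a path from `u` whose
reverse label is in `L`. -/
def transEdge (δ : Q → A → Option (A × Q)) (F L : Set (List Q)) (u : List A)
    (v : List A) (p o : List Q) (w : List A) : Prop :=
  p ∈ F ∧ ∃ fs : List (List Q), (∀ f ∈ fs, f ∈ F) ∧ (p :: fs).flatten ∈ L ∧
    (∃ r, runSeq δ fs.flatten u = some (v, r)) ∧ runSeq δ p v = some (w, o)

/-- Isomorphism of the `L`-orbital transducers over `F` of `u₁` and `u₂`: a bijection of
the node sets mapping `u₁` to `u₂` and preserving labeled edges in both directions. -/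
def TransducerIso (δ : Q → A → Option (A × Q)) (F L : Set (List Q)) (u₁ u₂ : List A) :
    Prop :=
  ∃ φ : List A → List A,
    Set.BijOn φ (transNodes δ F L u₁) (transNodes δ F L u₂) ∧ φ u₁ = u₂ ∧
    ∀ v ∈ transNodes δ F L u₁, ∀ w ∈ transNodes δ F L u₁, ∀ p o : List Q,
      (transEdge δ F L u₁ v p o w ↔ transEdge δ F L u₂ (φ v) p o (φ w))


section Runs

variable {Q A : Type*} (δ : Q → A → Option (A × Q))

theorem runState_append (q : Q) (u x : List A) :
    runState δ q (u ++ x) = (runState δ q u).bind fun vp =>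
      (runState δ vp.2 x).map fun yr => (vp.1 ++ yr.1, yr.2) := by
  induction u generalizing q with
  | nil => simp [runState]
  | cons a u ih =>
    simp only [List.cons_append, runState, Option.bind_assoc]
    congr 1
    funext bp
    rw [ih]
    cases runState δ bp.2 u <;> simp [Function.comp_def]

theorem stateAct_eq_map_runState (q : Q) (u : List A) :
    stateAct δ q u = (runState δ q u).map Prod.fst := by
  induction u generalizing q with
  | nil => simp [runState, stateAct]
  | cons a u ih => simp [runState, stateAct, ih, Function.comp_def, Option.map_bind]

theorem seqAct_cons (q : Q) (l : List Q) (u : List A) :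
    seqAct δ (q :: l) u = (seqAct δ l u).bind (stateAct δ q) := rfl

theorem seqAct_eq_map_runSeq (l : List Q) (u : List A) :
    seqAct δ l u = (runSeq δ l u).map Prod.fst := by
  induction l with
  | nil => simp [seqAct, runSeq]
  | cons q l ih =>
    rw [seqAct_cons, ih, runSeq]
    cases runSeq δ l u <;> simp [stateAct_eq_map_runState, Function.comp_def]

theorem runSeq_append (l : List Q) (u x : List A) :
    runSeq δ l (u ++ x) = (runSeq δ l u).bind fun vp =>
      (runSeq δ vp.2 x).map fun yr => (vp.1 ++ yr.1, yr.2) := by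
  induction l with
  | nil => simp [runSeq]
  | cons q l ih =>
    simp only [runSeq, ih]
    cases runSeq δ l u with
    | none => simp
    | some vr =>
      simp only [Option.bind_some, Option.bind_map, Function.comp_def, runState_append,
        Option.map_bind]
      cases runState δ q vr.1 with
      | none => simp
      | some wp => simp [runSeq, Option.map_bind, Function.comp_def]

theorem length_of_stateAct {q : Q} {u v : List A} (h : stateAct δ q u = some v) :
    v.length = u.length := by
  induction u generalizing q v with
  | nil => simp_all [stateAct]
  | cons a u ih =>
    simp only [stateAct, Option.bind_eq_some_iff, Option.map_eq_some_iff] at h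
    obtain ⟨bp, -, w, hw, rfl⟩ := h
    simp [ih hw]

theorem length_of_seqAct {l : List Q} {u v : List A} (h : seqAct δ l u = some v) :
    v.length = u.length := by
  induction l generalizing v with
  | nil => simp_all [seqAct]
  | cons q l ih =>
    rw [seqAct_cons, Option.bind_eq_some_iff] at h
    obtain ⟨w, hw, hv⟩ := h
    rw [length_of_stateAct δ hv, ih hw]

theorem length_of_runSeq {l r : List Q} {u v : List A} (h : runSeq δ l u = some (v, r)) :
    v.length = u.length :=
  length_of_seqAct δ (l := l) (by simp [seqAct_eq_map_runSeq, h])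

theorem stateAct_prefix {q : Q} {u x v : List A} (h : stateAct δ q (u ++ x) = some v) :
    stateAct δ q u = some (v.take u.length) := by
  rw [stateAct_eq_map_runState, runState_append] at h
  simp only [Option.map_eq_some_iff, Option.bind_eq_some_iff] at h
  obtain ⟨_, ⟨wp, hw, yr, -, rfl⟩, rfl⟩ := h
  have hs : stateAct δ q u = some wp.1 := by simp [stateAct_eq_map_runState, hw]
  rw [hs, ← length_of_stateAct δ hs]
  simp

theorem seqAct_append_eq_some_iff {l : List Q} {u x w : List A} :
    seqAct δ l (u ++ x) = some w ↔ ∃ v r y, runSeq δ l u = some (v, r) ∧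
      seqAct δ r x = some y ∧ w = v ++ y := by
  rw [seqAct_eq_map_runSeq, runSeq_append]
  simp only [Option.map_eq_some_iff, Option.bind_eq_some_iff, seqAct_eq_map_runSeq]
  constructor
  · rintro ⟨_, ⟨⟨v, r⟩, h, yr, hy, rfl⟩, rfl⟩
    exact ⟨v, r, yr.1, h, ⟨yr, hy, rfl⟩, rfl⟩
  · rintro ⟨v, r, _, h, ⟨yr, hy, rfl⟩, rfl⟩
    exact ⟨_, ⟨(v, r), h, yr, hy, rfl⟩, rfl⟩

theorem orbit_finite [Finite A] (L : Set (List Q)) (u : List A) : (orbit δ L u).Finite :=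
  (List.finite_length_eq A u.length).subset fun _ ⟨_, _, h⟩ => length_of_seqAct δ h

theorem self_mem_orbit (u : List A) : u ∈ orbit δ Set.univ u :=
  ⟨[], trivial, rfl⟩

end Runs

section Codes

variable {Q A : Type*} (δ : Q → A → Option (A × Q))

/-- A pointed transducer with node set `Fin N` reading and writing states, serving as the
isomorphism type of an orbital transducer with at most `N` nodes. -/
abbrev Code (Q : Type*) (N : ℕ) : Type _ := (Fin N → Q → Option (Fin N × Q)) × Fin N

/-- Run of a state sequence in a pointed transducer: final node and output. -/
def Code.run {N : ℕ} (c : Code Q N) : List Q → Option (Fin N × List Q)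
  | [] => some (c.2, [])
  | q :: l => (c.run l).bind fun nr => (c.1 nr.1 q).map fun mp => (mp.1, mp.2 :: nr.2)

/-- The orbit of `u ++ x` as seen by a transducer isomorphic to the orbital one of `u`. -/
def Code.orbit {N : ℕ} (c : Code Q N) (x : List A) : Set (Fin N × List A) :=
  {nv | ∃ l r, c.run l = some (nv.1, r) ∧ seqAct δ r x = some nv.2}

theorem exists_code [Finite A] {N : ℕ} {u : List A}
    (h : (orbit δ Set.univ u).ncard ≤ N) :
    ∃ (c : Code Q N) (φ : List A → Fin N), Set.InjOn φ (orbit δ Set.univ u) ∧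
      ∀ l, c.run l = (runSeq δ l u).map (Prod.map φ id) := by
  classical
  have hfin := orbit_finite δ Set.univ u
  have hpos : 0 < N :=
    lt_of_lt_of_le ((Set.ncard_pos hfin).2 ⟨u, self_mem_orbit δ u⟩) h
  have : Nonempty (Fin N) := ⟨⟨0, hpos⟩⟩
  obtain ⟨φ, -, hφ⟩ := hfin.exists_injOn_of_encard_le (t := (Set.univ : Set (Fin N)))
    (by rw [← hfin.cast_ncard_eq]; simpa using h)
  refine ⟨(fun n q => if hn : ∃ v ∈ orbit δ Set.univ u, φ v = n then
    (runState δ q hn.choose).map (Prod.map φ id) else none, φ u), φ, hφ, fun l => ?_⟩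
  induction l with
  | nil => simp [Code.run, runSeq]
  | cons q l ih =>
    rw [Code.run, ih, runSeq]
    cases hl : runSeq δ l u with
    | none => simp
    | some vr =>
      have hv : vr.1 ∈ orbit δ Set.univ u := ⟨l, trivial, by simp [seqAct_eq_map_runSeq, hl]⟩
      have hn : ∃ v ∈ orbit δ Set.univ u, φ v = φ vr.1 := ⟨_, hv, rfl⟩
      have hc : hn.choose = vr.1 := hφ hn.choose_spec.1 hv hn.choose_spec.2
      simp only [Option.map_some, Option.bind_some, Prod.map_fst, dif_pos hn, hc, Prod.map_snd,
        id, Option.map_map]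
      rfl

theorem ncard_orbit_append [Finite A] {N : ℕ} {u : List A} {c : Code Q N}
    {φ : List A → Fin N} (hφ : Set.InjOn φ (orbit δ Set.univ u))
    (hc : ∀ l, c.run l = (runSeq δ l u).map (Prod.map φ id)) (x : List A) :
    (orbit δ Set.univ (u ++ x)).ncard = (c.orbit δ x).ncard := by
  have himg : c.orbit δ x =
      (fun w : List A => (φ (w.take u.length), w.drop u.length)) ''
        orbit δ Set.univ (u ++ x) := by
    ext ⟨n, y⟩
    simp only [Code.orbit, Set.mem_ofPred_eq, Set.mem_image, orbit, Set.mem_univ, true_and, hc,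
      seqAct_append_eq_some_iff, Option.map_eq_some_iff]
    constructor
    · rintro ⟨l, r, ⟨⟨v, r'⟩, hl, he⟩, hy⟩
      simp only [Prod.map_apply, id, Prod.mk.injEq] at he
      obtain ⟨rfl, rfl⟩ := he
      refine ⟨v ++ y, ⟨l, v, r', y, hl, hy, rfl⟩, ?_⟩
      simp [← length_of_runSeq δ hl]
    · rintro ⟨_, ⟨l, v, r, y', hl, hy, rfl⟩, he⟩
      simp only [← length_of_runSeq δ hl, List.take_left', List.drop_left', Prod.mk.injEq] at he
      obtain ⟨rfl, rfl⟩ := he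
      exact ⟨l, r, ⟨(v, r), hl, rfl⟩, hy⟩
  rw [himg, Set.InjOn.ncard_image]
  rintro w ⟨l, -, hl⟩ w' ⟨l', -, hl'⟩ he
  rw [seqAct_append_eq_some_iff] at hl hl'
  obtain ⟨v, r, y, hl, -, rfl⟩ := hl
  obtain ⟨v', r', y', hl', -, rfl⟩ := hl'
  have e1 := length_of_runSeq δ hl
  have e2 := length_of_runSeq δ hl'
  simp only [Prod.mk.injEq, List.take_left' e1, List.drop_left' e1, List.take_left' e2,
    List.drop_left' e2] at he
  rw [he.2, hφ ⟨l, trivial, by simp [seqAct_eq_map_runSeq, hl]⟩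
    ⟨l', trivial, by simp [seqAct_eq_map_runSeq, hl']⟩ he.1]

theorem seqAct_eq_of_run_eq {N : ℕ} {u : List A} {c : Code Q N}
    {φ : List A → Fin N} (hφ : Set.InjOn φ (orbit δ Set.univ u))
    (hc : ∀ l, c.run l = (runSeq δ l u).map (Prod.map φ id)) {l l' : List Q}
    (h : (c.run l).map Prod.fst = (c.run l').map Prod.fst) :
    seqAct δ l u = seqAct δ l' u := by
  have key : ∀ l, (c.run l).map Prod.fst = (seqAct δ l u).map φ := fun l => by
    rw [hc, seqAct_eq_map_runSeq]
    simp [Function.comp_def]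
  rw [key, key] at h
  cases h1 : seqAct δ l u <;> cases h2 : seqAct δ l' u <;> simp_all
  exact hφ ⟨l, trivial, h1⟩ ⟨l', trivial, h2⟩ h

end Codes

section Potential

variable {Q A : Type*} (δ : Q → A → Option (A × Q))

theorem infinitePotential_nil_of_infinite [Finite Q] [Finite A] {L : Set (List Q)}
    (h : (mapsOf δ L).Infinite) : InfinitePotential δ Set.univ [] := by
  by_contra hb
  simp only [InfinitePotential, List.nil_append, not_forall, not_exists, not_lt] at hb
  obtain ⟨N, hN⟩ := hb
  apply h
  let F : List Q → Code Q N → Option (Fin N) := fun l c => (c.run l).map Prod.fst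
  have hF : (seqAct δ).FactorsThrough F := fun l l' hl => by
    funext u
    obtain ⟨c, φ, hφ, hc⟩ := exists_code δ (hN u)
    exact seqAct_eq_of_run_eq δ hφ hc (congrFun hl c)
  refine (Set.finite_range (Function.extend F (seqAct δ) fun _ _ => none)).subset ?_
  rintro _ ⟨l, -, rfl⟩
  exact ⟨F l, hF.extend_apply _ l⟩

theorem InfinitePotential.exists_append [Finite Q] [Finite A] {u : List A}
    (hu : InfinitePotential δ Set.univ u) (C : ℕ) :
    ∃ y, InfinitePotential δ Set.univ (u ++ y) ∧
      C < (AutOrbit.orbit δ Set.univ (u ++ y)).ncard := by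
  classical
  have := Fintype.ofFinite Q
  have := Fintype.ofFinite A
  by_contra! hC
  have hD : ∀ p : Code Q C × A, ∃ D : ℕ, (∃ D', ∀ z, (p.1.orbit δ (p.2 :: z)).ncard ≤ D') →
      ∀ z, (p.1.orbit δ (p.2 :: z)).ncard ≤ D := fun p => by
    by_cases h : ∃ D', ∀ z, (p.1.orbit δ (p.2 :: z)).ncard ≤ D'
    · exact ⟨h.choose, fun _ => h.choose_spec⟩
    · exact ⟨0, fun h' => absurd h' h⟩
  choose D hD using hD
  have key : ∀ x y, InfinitePotential δ Set.univ (u ++ y) →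
      (AutOrbit.orbit δ Set.univ (u ++ y ++ x)).ncard ≤ C + ∑ p, D p := by
    intro x
    induction x with
    | nil =>
      intro y hy
      rw [List.append_nil]
      exact (hC y hy).trans (Nat.le_add_right _ _)
    | cons a z ih =>
      intro y hy
      by_cases ha : InfinitePotential δ Set.univ (u ++ (y ++ [a]))
      · simpa using ih _ ha
      · obtain ⟨c, φ, hφ, hc⟩ := exists_code δ (hC y hy)
        have hcard := ncard_orbit_append δ hφ hc
        have hle := hD (c, a) (by
          simp only [InfinitePotential, not_forall, not_exists, not_lt] at ha
          obtain ⟨D', hD'⟩ := ha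
          refine ⟨D', fun z => ?_⟩
          rw [← hcard]
          simpa using hD' z) z
        rw [hcard]
        exact (hle.trans (Finset.single_le_sum (f := D) (fun _ _ => Nat.zero_le _)
          (Finset.mem_univ (c, a)))).trans (Nat.le_add_left _ _)
  obtain ⟨x, hx⟩ := hu (C + ∑ p, D p)
  exact absurd (key x [] (by simpa using hu)) (by simpa using hx)

end Potential

section OmegaWords

variable {Q A : Type*} (δ : Q → A → Option (A × Q))

@[simp]
theorem length_pre (ξ : ℕ → A) (n : ℕ) : (pre ξ n).length = n := by simp [pre]

@[simp]
theorem getElem_pre (ξ : ℕ → A) (n i : ℕ) (h : i < (pre ξ n).length) :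
    (pre ξ n)[i] = ξ i := by simp [pre]

theorem pre_injective : Function.Injective (pre : (ℕ → A) → ℕ → List A) := by
  intro ξ η h
  funext i
  have := congrArg (fun w => w[i]?) (congrFun h (i + 1))
  simpa [pre, -List.ofFn_succ] using this

theorem pre_append_drop (ξ : ℕ → A) {m n : ℕ} (h : m ≤ n) :
    pre ξ m ++ (pre ξ n).drop m = pre ξ n := by
  have : pre ξ m = (pre ξ n).take m := by
    apply List.ext_getElem
    · simpa using h
    · simp
  rw [this, List.take_append_drop]

/-- Every prefix chain of finite words of unbounded length is a chain of prefixes of an ω-word. -/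
theorem exists_pre_eq_of_chain (w : ℕ → List A) (hw : ∀ n, w n <+: w (n + 1))
    (hlen : ∀ n, n ≤ (w n).length) : ∃ ξ : ℕ → A, ∀ n, pre ξ (w n).length = w n := by
  have hmono : ∀ m n, m ≤ n → w m <+: w n := fun m n h => by
    induction n, h using Nat.le_induction with
    | base => exact List.prefix_refl _
    | succ n _ ih => exact ih.trans (hw n)
  refine ⟨fun i => (w (i + 1))[i]'(hlen (i + 1)), fun n => ?_⟩
  apply List.ext_getElem
  · simp
  · intro i h1 h2
    rw [getElem_pre]
    rcases le_total n (i + 1) with h | h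
    · exact ((hmono _ _ h).getElem h2).symm
    · exact (hmono _ _ h).getElem (hlen (i + 1))

/-- A state defined on all prefixes of an ω-word acts on the ω-word. -/
theorem exists_stateAct_pre {q : Q} {η : ℕ → A}
    (h : ∀ n, (stateAct δ q (pre η n)).isSome) :
    ∃ ζ : ℕ → A, ∀ n, stateAct δ q (pre η n) = some (pre ζ n) := by
  choose w hw using fun n => Option.isSome_iff_exists.1 (h n)
  have hlen : ∀ n, (w n).length = n := fun n => by simpa using length_of_stateAct δ (hw n)
  obtain ⟨ζ, hζ⟩ := exists_pre_eq_of_chain w (fun n => by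
    have h1 := hw (n + 1)
    rw [← pre_append_drop η n.le_succ] at h1
    have h2 := stateAct_prefix δ h1
    rw [hw n, Option.some_inj] at h2
    rw [h2]
    exact List.take_prefix _ _) (fun n => (hlen n).ge)
  refine ⟨ζ, fun n => ?_⟩
  rw [hw n, ← hζ n, hlen n]

/-- A finite orbit of an ω-word bounds the orbits of all its long enough prefixes. -/
theorem exists_ncard_orbit_pre_le [Finite Q] {ξ : ℕ → A}
    (h : (omegaOrbit δ Set.univ ξ).Finite) :
    ∃ M, ∀ n, M ≤ n → (orbit δ Set.univ (pre ξ n)).ncard ≤ (omegaOrbit δ Set.univ ξ).ncard := by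
  have step : ∀ p : omegaOrbit δ Set.univ ξ × Q, ∀ᶠ n in Filter.atTop, ∀ v,
      stateAct δ p.2 (pre p.1.1 n) = some v →
        v ∈ (fun η => pre η n) '' omegaOrbit δ Set.univ ξ := by
    rintro ⟨⟨η, l, -, hl⟩, q⟩
    by_cases hd : ∀ n, (stateAct δ q (pre η n)).isSome
    · obtain ⟨ζ, hζ⟩ := exists_stateAct_pre δ hd
      refine Filter.Eventually.of_forall fun n v hv => ⟨ζ, ⟨q :: l, trivial, fun m => ?_⟩, ?_⟩
      · rw [seqAct_cons, hl m, Option.bind_some, hζ]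
      · exact Option.some_inj.1 ((hζ n).symm.trans hv)
    · push Not at hd
      obtain ⟨M, hM⟩ := hd
      filter_upwards [Filter.eventually_ge_atTop M] with n hn v hv
      rw [← pre_append_drop η hn] at hv
      simp [stateAct_prefix δ hv] at hM
  have := h.to_subtype
  obtain ⟨M, hM⟩ := Filter.eventually_atTop.1 (Filter.eventually_all.2 step)
  refine ⟨M, fun n hn => ?_⟩
  have hsub : orbit δ Set.univ (pre ξ n) ⊆
      (fun η => pre η n) '' omegaOrbit δ Set.univ ξ := by
    rintro v ⟨l, -, hl⟩
    induction l generalizing v with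
    | nil => exact ⟨ξ, ⟨[], trivial, fun _ => rfl⟩, by simpa [seqAct] using hl⟩
    | cons q l ih =>
      rw [seqAct_cons, Option.bind_eq_some_iff] at hl
      obtain ⟨w, hw, hv⟩ := hl
      obtain ⟨η, hη, rfl⟩ := ih hw
      exact hM n hn (⟨η, hη⟩, q) v hv
  exact (Set.ncard_le_ncard hsub (h.image _)).trans (Set.ncard_image_le h)

theorem exists_infinite_omegaOrbit [Finite Q] [Finite A]
    (h : InfinitePotential δ Set.univ []) :
    ∃ ξ : ℕ → A, (omegaOrbit δ (Set.univ : Set (List Q)) ξ).Infinite := by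
  have hext : ∀ (n : ℕ) (u : {u : List A // InfinitePotential δ Set.univ u}),
      ∃ v : {u : List A // InfinitePotential δ Set.univ u}, u.1 <+: v.1 ∧
        u.1.length < v.1.length ∧ n < (orbit δ Set.univ v.1).ncard := by
    rintro n ⟨u, hu⟩
    obtain ⟨y, hy, hcard⟩ := hu.exists_append δ (max n (orbit δ Set.univ u).ncard)
    rw [max_lt_iff] at hcard
    refine ⟨⟨u ++ y, hy⟩, List.prefix_append _ _, ?_, hcard.1⟩
    rcases y with - | ⟨a, y⟩
    · simp at hcard
    · simp
  choose f hpre hlt hcard using hext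
  let w : ℕ → {u : List A // InfinitePotential δ Set.univ u} := fun n =>
    Nat.rec ⟨[], h⟩ f n
  have hlen : ∀ n, n ≤ (w n).1.length := fun n => by
    induction n with
    | zero => exact Nat.zero_le _
    | succ n ih => exact ih.trans_lt (hlt n (w n))
  obtain ⟨ξ, hξ⟩ := exists_pre_eq_of_chain (fun n => (w n).1) (fun n => hpre n (w n)) hlen
  refine ⟨ξ, fun hfin => ?_⟩
  obtain ⟨M, hM⟩ := exists_ncard_orbit_pre_le δ hfin
  set k := (omegaOrbit δ Set.univ ξ).ncard
  have h1 := hM (w (max M k + 1)).1.length (by have := hlen (max M k + 1); omega)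
  rw [hξ (max M k + 1)] at h1
  have h2 : max M k < (orbit δ Set.univ (w (max M k + 1)).1).ncard := hcard _ _
  omega

theorem infinite_mapsOf_of_infinite_omegaOrbit {L : Set (List Q)} {ξ : ℕ → A}
    (h : (omegaOrbit δ L ξ).Infinite) : (mapsOf δ L).Infinite := by
  choose! l hl hact using fun η (hη : η ∈ omegaOrbit δ L ξ) => hη
  refine Set.infinite_of_injOn_mapsTo (f := fun η => seqAct δ (l η)) (fun η hη ζ hζ he => ?_)
    (fun η hη => ⟨l η, hl η hη, rfl⟩) h
  apply pre_injective
  funext n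
  simpa [hact η hη n, hact ζ hζ n] using congrFun he (pre ξ n)

end OmegaWords

/-- The automaton semigroup `S(T) = {𝐪∘ ∣ 𝐪 ∈ Q⁺}` is infinite iff
there is an ω-word `ξ ∈ Σ^ω` with infinite orbit `Q*∘ξ`. -/
theorem semigroup_infinite_iff_omegaOrbit_infinite {Q A : Type*} [Fintype Q] [Fintype A]
    [Nonempty A] (δ : Q → A → Option (A × Q)) :
    (mapsOf δ {l : List Q | l ≠ []}).Infinite ↔
      ∃ ξ : ℕ → A, (omegaOrbit δ (Set.univ : Set (List Q)) ξ).Infinite := by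
  constructor
  · exact fun h => exists_infinite_omegaOrbit δ (infinitePotential_nil_of_infinite δ h)
  · rintro ⟨ξ, hξ⟩ hfin
    refine infinite_mapsOf_of_infinite_omegaOrbit δ hξ
      ((hfin.insert (seqAct δ [])).subset ?_)
    rintro _ ⟨l, -, rfl⟩
    rcases eq_or_ne l [] with rfl | hl
    · exact Set.mem_insert _ _
    · exact Set.mem_insert_of_mem _ ⟨l, hl, rfl⟩

end AutOrbit
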